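/- (Orthogonality of computed left singular vectors.) Let A = B·D be a real m×n matrix of full column rank, where D is an n×n diagonal matrix with positive diagonal entries and the columns of B have unit Euclidean norm. Let Ṽ be a real n×n orthogonal matrix, Ŝ an n×n diagonal matrix with positive diagonal entries, and Σ̃ the diagonal matrix with Σ̃_{ii} = √(Ŝ_{ii}). Suppose ΔM, ΔM̂, ΔS are n×n matrices with |ΔM| ≤ ε_M |A|ᵀ|A| entrywise, ‖D⁻¹ ΔM̂ D⁻¹‖ ≤ ε_eig ‖B‖², Ṽᵀ(AᵀA + ΔM + ΔM̂)Ṽ = Ŝ + ΔS, and |ΔS_{ij}| ≤ ε_tol Σ̃_{ii} Σ̃_{jj} for all i, j. Let Σ̂ be the diagonal matrix with Σ̂_{ii} = σ̂_i := Σ̃_{ii}(1 + δ_i), |δ_i| ≤ ε_sqrt < 1/2, and let Û be an m×n matrix with |Û − A Ṽ Σ̂⁻¹| ≤ ε' |A| |Ṽ| Σ̂⁻¹ entrywise, where ε' := ε_V + ε_U(1+ε_V) for some ε_V, ε_U ≥ 0 with ε' ≤ 1. If ε₁ := 2ε_tol + 2(n² ε_M + ε_eig) κ(B)² + 4n√n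 ε' κ(B) ≤ 1/2, then ‖ÛᵀÛ − I‖_F ≤ (2√n ε_sqrt + n ε₁) / (1 − 2ε_sqrt). -/

import Mathlib

open Matrix BigOperators

/-- Euclidean norm of a vector. -/
noncomputable def vnorm {k : ℕ} (v : Fin k → ℝ) : ℝ := Real.sqrt (∑ i, (v i)^2)

/-- Spectral norm (operator 2-norm) of a real matrix. -/
noncomputable def spec {m n : ℕ} (A : Matrix (Fin m) (Fin n) ℝ) : ℝ :=
  ‖(Matrix.toEuclideanLin A).toContinuousLinearMap‖

/-- Moore–Penrose pseudoinverse of a full-column-rank matrix. -/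
noncomputable def pinv {m n : ℕ} (A : Matrix (Fin m) (Fin n) ℝ) : Matrix (Fin n) (Fin m) ℝ :=
  (Aᵀ * A)⁻¹ * Aᵀ

/-- Condition number κ(B) = ‖B‖ ‖B†‖. -/
noncomputable def kappa {m n : ℕ} (B : Matrix (Fin m) (Fin n) ℝ) : ℝ :=
  spec B * spec (pinv B)

/-- Frobenius norm of a real matrix. -/
noncomputable def frob {m n : ℕ} (M : Matrix (Fin m) (Fin n) ℝ) : ℝ :=
  Real.sqrt (∑ i, ∑ j, (M i j)^2)

theorem vnorm_nonneg {k : ℕ} (v : Fin k → ℝ) : 0 ≤ vnorm v := Real.sqrt_nonneg _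

theorem vnorm_sq {k : ℕ} (v : Fin k → ℝ) : vnorm v ^ 2 = ∑ i, (v i) ^ 2 :=
  Real.sq_sqrt (Finset.sum_nonneg fun _ _ => sq_nonneg _)

theorem vnorm_eq_norm {k : ℕ} (v : Fin k → ℝ) : vnorm v = ‖WithLp.toLp 2 v‖ := by
  simp [vnorm, EuclideanSpace.norm_eq]

theorem sum_abs_mul_abs_le {k : ℕ} (v w : Fin k → ℝ) :
    ∑ i, |v i| * |w i| ≤ vnorm v * vnorm w := by
  simpa [vnorm] using Real.sum_mul_le_sqrt_mul_sqrt Finset.univ (fun i => |v i|) (fun i => |w i|)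

theorem abs_dotProduct_le {k : ℕ} (v w : Fin k → ℝ) : |v ⬝ᵥ w| ≤ vnorm v * vnorm w :=
  (Finset.abs_sum_le_sum_abs _ _).trans <| by
    simpa only [abs_mul] using sum_abs_mul_abs_le v w

theorem dotProduct_self_eq_vnorm_sq {k : ℕ} (v : Fin k → ℝ) : v ⬝ᵥ v = vnorm v ^ 2 := by
  rw [vnorm_sq]
  exact Finset.sum_congr rfl fun _ _ => (sq _).symm

theorem sum_abs_le {k : ℕ} (v : Fin k → ℝ) : ∑ i, |v i| ≤ Real.sqrt k * vnorm v := by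
  simpa [vnorm] using sum_abs_mul_abs_le (fun _ => 1) v

theorem vnorm_mulVec_le {m n : ℕ} (A : Matrix (Fin m) (Fin n) ℝ) (x : Fin n → ℝ) :
    vnorm (A *ᵥ x) ≤ spec A * vnorm x := by
  rw [vnorm_eq_norm, vnorm_eq_norm, spec]
  exact (Matrix.toEuclideanLin A).toContinuousLinearMap.le_opNorm (WithLp.toLp 2 x)

theorem spec_nonneg {m n : ℕ} (A : Matrix (Fin m) (Fin n) ℝ) : 0 ≤ spec A := norm_nonneg _

theorem vnorm_col_le_spec {m n : ℕ} (B : Matrix (Fin m) (Fin n) ℝ) (j : Fin n) :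
    vnorm (fun k => B k j) ≤ spec B := by
  have h := vnorm_mulVec_le B (Pi.single j 1)
  have h1 : vnorm (Pi.single j (1 : ℝ) : Fin n → ℝ) = 1 := by
    simp [vnorm_eq_norm]
  rw [h1, mul_one, Matrix.mulVec_single_one] at h
  exact h

theorem pinv_mul_self {m n : ℕ} {B : Matrix (Fin m) (Fin n) ℝ} (hB : B.rank = n) :
    pinv B * B = 1 := by
  have hr : (Bᵀ * B).rank = n := by rw [Matrix.rank_transpose_mul_self, hB]
  have hu : IsUnit (Bᵀ * B) := by
    rw [← Matrix.mulVec_surjective_iff_isUnit]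
    have h : LinearMap.range (Bᵀ * B).mulVecLin = ⊤ :=
      Submodule.eq_top_of_finrank_eq (by simpa [Matrix.rank] using hr)
    exact LinearMap.range_eq_top.mp h
  rw [pinv, Matrix.mul_assoc, Matrix.nonsing_inv_mul _ ((Matrix.isUnit_iff_isUnit_det _).mp hu)]

theorem transpose_mul_mul_apply {m n p : ℕ} (X : Matrix (Fin m) (Fin n) ℝ)
    (E : Matrix (Fin m) (Fin m) ℝ) (Y : Matrix (Fin m) (Fin p) ℝ) (i : Fin n) (j : Fin p) :
    (Xᵀ * E * Y) i j = Xᵀ i ⬝ᵥ E *ᵥ Yᵀ j := by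
  rw [Matrix.mul_assoc]
  rfl

/-- A bilinear form with bounded coefficients. -/
theorem abs_dotProduct_mulVec_le_of_entries {n : ℕ} {E : Matrix (Fin n) (Fin n) ℝ} {ε : ℝ}
    (hε : 0 ≤ ε) (hE : ∀ i j, |E i j| ≤ ε) (x y : Fin n → ℝ) :
    |x ⬝ᵥ E *ᵥ y| ≤ n * ε * (vnorm x * vnorm y) := by
  calc |x ⬝ᵥ E *ᵥ y| ≤ ∑ k, |x k| * (ε * ∑ l, |y l|) := by
        refine (Finset.abs_sum_le_sum_abs _ _).trans (Finset.sum_le_sum fun k _ => ?_)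
        rw [abs_mul]
        refine mul_le_mul_of_nonneg_left ?_ (abs_nonneg _)
        refine (Finset.abs_sum_le_sum_abs (fun l => E k l * y l) Finset.univ).trans ?_
        rw [Finset.mul_sum]
        refine Finset.sum_le_sum fun l _ => ?_
        rw [abs_mul]
        exact mul_le_mul_of_nonneg_right (hE k l) (abs_nonneg _)
    _ = ε * ((∑ k, |x k|) * ∑ l, |y l|) := by rw [← Finset.sum_mul]; ring
    _ ≤ ε * ((Real.sqrt n * vnorm x) * (Real.sqrt n * vnorm y)) := by
        refine mul_le_mul_of_nonneg_left ?_ hε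
        exact mul_le_mul (sum_abs_le x) (sum_abs_le y)
          (Finset.sum_nonneg fun _ _ => abs_nonneg _)
          (mul_nonneg (Real.sqrt_nonneg _) (vnorm_nonneg _))
    _ = (Real.sqrt n * Real.sqrt n) * ε * (vnorm x * vnorm y) := by ring
    _ = n * ε * (vnorm x * vnorm y) := by rw [Real.mul_self_sqrt (Nat.cast_nonneg n)]

theorem frob_le_of_entries {n : ℕ} {M : Matrix (Fin n) (Fin n) ℝ} {a b : ℝ}
    (ha : 0 ≤ a) (hb : 0 ≤ b) (hM : ∀ i j, |M i j| ≤ (if i = j then a else 0) + b) :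
    frob M ≤ Real.sqrt n * a + n * b := by
  have hs : Real.sqrt n ^ 2 = n := Real.sq_sqrt (Nat.cast_nonneg n)
  have hsum : ∑ i : Fin n, ∑ j : Fin n, ((if i = j then a else 0) + b) ^ 2
      = n * (a ^ 2 + 2 * a * b) + n * n * b ^ 2 := by
    have h : ∀ i j : Fin n, ((if i = j then a else 0) + b) ^ 2
        = (if i = j then a ^ 2 + 2 * a * b else 0) + b ^ 2 := by
      intro i j
      split_ifs <;> ring
    simp only [h, Finset.sum_add_distrib, Finset.sum_ite_eq, Finset.mem_univ, if_true,
      Finset.sum_const, Finset.card_univ, Fintype.card_fin, nsmul_eq_mul]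
    ring
  refine Real.sqrt_le_iff.mpr ⟨by positivity, ?_⟩
  calc ∑ i, ∑ j, (M i j) ^ 2
      ≤ ∑ i : Fin n, ∑ j : Fin n, ((if i = j then a else 0) + b) ^ 2 :=
        Finset.sum_le_sum fun i _ => Finset.sum_le_sum fun j _ => by
          rw [← sq_abs]
          exact pow_le_pow_left₀ (abs_nonneg _) (hM i j) 2
    _ = n * (a ^ 2 + 2 * a * b) + n * n * b ^ 2 := hsum
    _ ≤ (Real.sqrt n * a + n * b) ^ 2 := by
        rcases Nat.eq_zero_or_pos n with rfl | hn
        · simp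
        have h1 : 1 ≤ Real.sqrt n := Real.one_le_sqrt.mpr (by exact_mod_cast hn)
        have h2 : 0 ≤ (n : ℝ) * a * b * (Real.sqrt n - 1) :=
          mul_nonneg (by positivity) (by linarith)
        have h3 : (Real.sqrt n * a + n * b) ^ 2 = Real.sqrt n ^ 2 * a ^ 2
            + 2 * Real.sqrt n * n * a * b + n * n * b ^ 2 := by ring
        rw [h3, hs]
        linarith

/-- Columnwise norm bound for a matrix dominated entrywise by `c |B| |X|`. -/
theorem vnorm_col_le_of_abs_le {m n p : ℕ} {B : Matrix (Fin m) (Fin n) ℝ}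
    {X : Matrix (Fin n) (Fin p) ℝ} {F : Matrix (Fin m) (Fin p) ℝ} {c : ℝ} (hc : 0 ≤ c)
    (hBcols : ∀ i, vnorm (fun k => B k i) = 1)
    (hF : ∀ k j, |F k j| ≤ c * ∑ l, |B k l| * |X l j|) (j : Fin p) :
    vnorm (Fᵀ j) ≤ c * Real.sqrt n * vnorm (Xᵀ j) := by
  have hX := vnorm_nonneg (Xᵀ j)
  refine Real.sqrt_le_iff.mpr ⟨by positivity, ?_⟩
  have hB : ∑ k, vnorm (B k) ^ 2 = n := by
    simp only [vnorm_sq]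
    rw [Finset.sum_comm]
    simp only [← vnorm_sq (fun k => B k _), hBcols]
    simp
  calc ∑ k, (Fᵀ j k) ^ 2 ≤ ∑ k, c ^ 2 * vnorm (Xᵀ j) ^ 2 * vnorm (B k) ^ 2 := by
        refine Finset.sum_le_sum fun k _ => ?_
        have h := (hF k j).trans
          (mul_le_mul_of_nonneg_left (sum_abs_mul_abs_le (B k) (Xᵀ j)) hc)
        calc (Fᵀ j k) ^ 2 = |F k j| ^ 2 := (sq_abs _).symm
          _ ≤ _ := pow_le_pow_left₀ (abs_nonneg _) h 2
          _ = _ := by ring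
    _ = (c * Real.sqrt n * vnorm (Xᵀ j)) ^ 2 := by
        rw [← Finset.mul_sum, hB, mul_pow, mul_pow, Real.sq_sqrt (Nat.cast_nonneg n)]
        ring

/-- Column norm bound from a relative perturbation bound on its Gram matrix. -/
theorem vnorm_mul_vnorm_le {m n : ℕ} {W : Matrix (Fin m) (Fin n) ℝ} {ε η : ℝ}
    (hε : 0 ≤ ε) (h : ε + η ≤ 1 / 4)
    (hW : ∀ i j, |Wᵀ i ⬝ᵥ Wᵀ j - (1 : Matrix (Fin n) (Fin n) ℝ) i j|
      ≤ ε + η * (vnorm (Wᵀ i) * vnorm (Wᵀ j))) (i j : Fin n) :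
    vnorm (Wᵀ i) * vnorm (Wᵀ j) ≤ 4 / 3 := by
  have hsq : ∀ i, vnorm (Wᵀ i) ^ 2 ≤ 4 / 3 := by
    intro i
    have h1 := (abs_le.mp (hW i i)).2
    rw [dotProduct_self_eq_vnorm_sq, Matrix.one_apply_eq] at h1
    nlinarith [sq_nonneg (vnorm (Wᵀ i))]
  nlinarith [hsq i, hsq j, sq_nonneg (vnorm (Wᵀ i) - vnorm (Wᵀ j))]

theorem abs_gram_add_sub_one_le {m n : ℕ} {W F : Matrix (Fin m) (Fin n) ℝ} {ε η φ : ℝ}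
    (hε : 0 ≤ ε) (hη : 0 ≤ η) (h : ε + η ≤ 1 / 4) (hφ : 0 ≤ φ) (hφ' : φ ≤ 1 / 8)
    (hW : ∀ i j, |Wᵀ i ⬝ᵥ Wᵀ j - (1 : Matrix (Fin n) (Fin n) ℝ) i j|
      ≤ ε + η * (vnorm (Wᵀ i) * vnorm (Wᵀ j)))
    (hF : ∀ j, vnorm (Fᵀ j) ≤ φ * vnorm (Wᵀ j)) (i j : Fin n) :
    |((W + F)ᵀ * (W + F) - (1 : Matrix (Fin n) (Fin n) ℝ)) i j| ≤ 2 * ε + 2 * η + 4 * φ := by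
  have hWW := vnorm_mul_vnorm_le hε h hW i j
  have hi := vnorm_nonneg (Wᵀ i)
  have hj := vnorm_nonneg (Wᵀ j)
  have hexp : ((W + F)ᵀ * (W + F) - (1 : Matrix (Fin n) (Fin n) ℝ)) i j =
      (Wᵀ i ⬝ᵥ Wᵀ j - (1 : Matrix (Fin n) (Fin n) ℝ) i j) + Wᵀ i ⬝ᵥ Fᵀ j
        + Fᵀ i ⬝ᵥ Wᵀ j + Fᵀ i ⬝ᵥ Fᵀ j := by
    have h1 : ((W + F)ᵀ * (W + F)) i j = (Wᵀ i + Fᵀ i) ⬝ᵥ (Wᵀ j + Fᵀ j) := rfl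
    rw [Matrix.sub_apply, h1]
    simp only [add_dotProduct, dotProduct_add]
    ring
  have h1 : |Wᵀ i ⬝ᵥ Fᵀ j| ≤ φ * (vnorm (Wᵀ i) * vnorm (Wᵀ j)) :=
    (abs_dotProduct_le _ _).trans <|
      (mul_le_mul_of_nonneg_left (hF j) hi).trans_eq (by ring)
  have h2 : |Fᵀ i ⬝ᵥ Wᵀ j| ≤ φ * (vnorm (Wᵀ i) * vnorm (Wᵀ j)) :=
    (abs_dotProduct_le _ _).trans <|
      (mul_le_mul_of_nonneg_right (hF i) hj).trans_eq (by ring)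
  have h3 : |Fᵀ i ⬝ᵥ Fᵀ j| ≤ φ ^ 2 * (vnorm (Wᵀ i) * vnorm (Wᵀ j)) :=
    (abs_dotProduct_le _ _).trans <|
      (mul_le_mul (hF i) (hF j) (vnorm_nonneg _) (by positivity)).trans_eq (by ring)
  have h4 := hW i j
  rw [hexp]
  have h5 := abs_add_le (Wᵀ i ⬝ᵥ Wᵀ j - (1 : Matrix (Fin n) (Fin n) ℝ) i j + Wᵀ i ⬝ᵥ Fᵀ j
        + Fᵀ i ⬝ᵥ Wᵀ j) (Fᵀ i ⬝ᵥ Fᵀ j)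
  have h6 := abs_add_three (Wᵀ i ⬝ᵥ Wᵀ j - (1 : Matrix (Fin n) (Fin n) ℝ) i j)
    (Wᵀ i ⬝ᵥ Fᵀ j) (Fᵀ i ⬝ᵥ Wᵀ j)
  have h7 : (η + 2 * φ + φ ^ 2) * (vnorm (Wᵀ i) * vnorm (Wᵀ j))
      ≤ (η + 2 * φ + φ ^ 2) * (4 / 3) := mul_le_mul_of_nonneg_left hWW (by positivity)
  have h8 : φ ^ 2 ≤ φ * (1 / 8) := by
    rw [sq]
    exact mul_le_mul_of_nonneg_left hφ' hφ
  linarith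

theorem abs_inv_one_add_sq_sub_one_le {δ ε : ℝ} (hδ : |δ| ≤ ε) (hε : ε < 1 / 2) :
    |(1 + δ)⁻¹ * (1 + δ)⁻¹ - 1| ≤ 2 * ε / (1 - 2 * ε) := by
  obtain ⟨h1, h2⟩ := abs_le.mp hδ
  have h0 : 0 < 1 + δ := by linarith
  have hε0 : 0 ≤ ε := (abs_nonneg _).trans hδ
  have he : (1 + δ)⁻¹ * (1 + δ)⁻¹ - 1 = -(2 * δ + δ ^ 2) / (1 + δ) ^ 2 := by
    field_simp
    ring
  have hlow : 1 - 2 * ε ≤ (1 + δ) ^ 2 := by nlinarith [sq_nonneg δ]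
  have hsq : δ ^ 2 ≤ ε ^ 2 := sq_le_sq.mpr (hδ.trans (le_abs_self ε))
  have h2e : 0 < 1 - 2 * ε := by linarith
  rw [he, abs_div, abs_of_pos (show 0 < (1 + δ) ^ 2 by positivity),
    div_le_div_iff₀ (by positivity) h2e, abs_neg]
  rcases abs_cases (2 * δ + δ ^ 2) with ⟨h, _⟩ | ⟨h, _⟩ <;> rw [h] <;>
    nlinarith [mul_nonneg hε0 (sq_nonneg δ), mul_nonneg hε0 hε0]

theorem abs_inv_one_add_mul_le {δ δ' ε : ℝ} (hδ : |δ| ≤ ε) (hδ' : |δ'| ≤ ε) (hε : ε < 1 / 2) :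
    |(1 + δ)⁻¹ * (1 + δ')⁻¹| ≤ 1 / (1 - 2 * ε) := by
  have h1 := (abs_le.mp hδ).1
  have h2 := (abs_le.mp hδ').1
  have h1' : 1 - ε ≤ 1 + δ := by linarith
  have h2' : 1 - ε ≤ 1 + δ' := by linarith
  have h3 : 0 < 1 - ε := by linarith [abs_nonneg δ]
  have h4 : 0 < 1 + δ := by linarith
  have h5 : 0 < 1 + δ' := by linarith
  rw [← mul_inv, abs_of_pos (by positivity), ← one_div]
  refine one_div_le_one_div_of_le (by linarith) ?_
  nlinarith [mul_le_mul h1' h2' h3.le h4.le, sq_nonneg ε]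

/-- Effect of a column rescaling by `(1 + δ)⁻¹` on a near-orthonormal matrix. -/
theorem frob_gram_scaled_sub_one_le {m n : ℕ} {Y : Matrix (Fin m) (Fin n) ℝ} {δ : Fin n → ℝ}
    {ε e : ℝ} (hδ : ∀ i, |δ i| ≤ ε) (hε0 : 0 ≤ ε) (hε : ε < 1 / 2) (he : 0 ≤ e)
    (hY : ∀ i j, |(Yᵀ * Y - (1 : Matrix (Fin n) (Fin n) ℝ)) i j| ≤ e) :
    frob ((Y * diagonal fun i => (1 + δ i)⁻¹)ᵀ * (Y * diagonal fun i => (1 + δ i)⁻¹) - 1)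
      ≤ (2 * Real.sqrt n * ε + n * e) / (1 - 2 * ε) := by
  have h2e : 0 < 1 - 2 * ε := by linarith
  have key := frob_le_of_entries
    (M := (Y * diagonal fun i => (1 + δ i)⁻¹)ᵀ * (Y * diagonal fun i => (1 + δ i)⁻¹) - 1)
    (a := 2 * ε / (1 - 2 * ε)) (b := 1 / (1 - 2 * ε) * e) (by positivity) (by positivity) ?_
  · refine key.trans_eq ?_
    field_simp
  intro i j
  have hent : ((Y * diagonal fun i => (1 + δ i)⁻¹)ᵀ * (Y * diagonal fun i => (1 + δ i)⁻¹) - (1 : Matrix (Fin n) (Fin n) ℝ)) i j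
      = ((1 + δ i)⁻¹ * (1 + δ j)⁻¹ - 1) * (1 : Matrix (Fin n) (Fin n) ℝ) i j
        + (1 + δ i)⁻¹ * (1 + δ j)⁻¹ * (Yᵀ * Y - (1 : Matrix (Fin n) (Fin n) ℝ)) i j := by
    rw [Matrix.transpose_mul, Matrix.diagonal_transpose, ← Matrix.mul_assoc, Matrix.mul_assoc _ Yᵀ,
      Matrix.sub_apply, Matrix.mul_diagonal, Matrix.diagonal_mul, Matrix.sub_apply]
    ring
  rw [hent]
  refine (abs_add_le _ _).trans (add_le_add ?_ ?_)
  · by_cases hij : i = j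
    · subst hij
      simpa using abs_inv_one_add_sq_sub_one_le (hδ i) hε
    · simp [hij]
  · rw [abs_mul]
    exact mul_le_mul (abs_inv_one_add_mul_le (hδ i) (hδ j) hε) (hY i j) (abs_nonneg _)
      (by positivity)

/-- Entries of the perturbation after two-sided diagonal scaling by the column norms. -/
theorem abs_scaled_entry_le {m n : ℕ} {A B : Matrix (Fin m) (Fin n) ℝ} {d : Fin n → ℝ}
    (hd : ∀ i, 0 < d i) (hA : A = B * diagonal d) (hBcols : ∀ i, vnorm (fun k => B k i) = 1)
    {E : Matrix (Fin n) (Fin n) ℝ} {ε : ℝ} (hε : 0 ≤ ε)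
    (hE : ∀ i j, |E i j| ≤ ε * (((A.map (fun x => |x|))ᵀ * A.map (fun x => |x|)) i j))
    (i j : Fin n) :
    |(diagonal (fun i => (d i)⁻¹) * E * diagonal (fun i => (d i)⁻¹)) i j| ≤ ε := by
  have hi := hd i
  have hj := hd j
  have h1 : ((A.map (fun x => |x|))ᵀ * A.map (fun x => |x|)) i j
      = d i * d j * ∑ k, |B k i| * |B k j| := by
    rw [Matrix.mul_apply, Finset.mul_sum]
    refine Finset.sum_congr rfl fun k _ => ?_
    simp only [hA, Matrix.transpose_apply, Matrix.map_apply, Matrix.mul_diagonal, abs_mul,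
      abs_of_pos hi, abs_of_pos hj]
    ring
  have h2 : ∑ k, |B k i| * |B k j| ≤ 1 := by
    simpa [hBcols] using sum_abs_mul_abs_le (fun k => B k i) (fun k => B k j)
  have h3 : |E i j| ≤ ε * (d i * d j) := (hE i j).trans <| by
    rw [h1]
    exact mul_le_mul_of_nonneg_left (mul_le_of_le_one_right (by positivity) h2) hε
  rw [Matrix.mul_diagonal, Matrix.diagonal_mul, abs_mul, abs_mul, abs_of_pos (inv_pos.mpr hi),
    abs_of_pos (inv_pos.mpr hj)]
  calc (d i)⁻¹ * |E i j| * (d j)⁻¹ ≤ (d i)⁻¹ * (ε * (d i * d j)) * (d j)⁻¹ := by gcongr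
    _ = ε := by field_simp

/-- orthogonality of the computed left singular vectors. -/
theorem stmt_12 {m n : ℕ} (A B : Matrix (Fin m) (Fin n) ℝ)
    (d : Fin n → ℝ) (hd : ∀ i, 0 < d i)
    (hA : A = B * Matrix.diagonal d) (hrank : A.rank = n)
    (hBcols : ∀ i, vnorm (fun k => B k i) = 1)
    (V : Matrix (Fin n) (Fin n) ℝ) (hV : Vᵀ * V = 1)
    (s : Fin n → ℝ) (hs : ∀ i, 0 < s i)
    (ΔM ΔMh ΔS : Matrix (Fin n) (Fin n) ℝ)
    (εM εeig εtol εsqrt εV εU : ℝ)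
    (hεM : 0 ≤ εM) (hεeig : 0 ≤ εeig) (hεtol : 0 ≤ εtol)
    (hεsqrt : 0 ≤ εsqrt) (hεsqrt' : εsqrt < 1/2)
    (hεV : 0 ≤ εV) (hεU : 0 ≤ εU)
    (hΔM : ∀ i j, |ΔM i j| ≤
      εM * (((A.map (fun x => |x|))ᵀ * A.map (fun x => |x|)) i j))
    (hΔMh : spec (Matrix.diagonal (fun i => (d i)⁻¹) * ΔMh *
      Matrix.diagonal (fun i => (d i)⁻¹)) ≤ εeig * spec B ^ 2)
    (heig : Vᵀ * (Aᵀ * A + ΔM + ΔMh) * V = Matrix.diagonal s + ΔS)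
    (hΔS : ∀ i j, |ΔS i j| ≤ εtol * (Real.sqrt (s i) * Real.sqrt (s j)))
    (σhat δ : Fin n → ℝ)
    (hσhat : ∀ i, σhat i = Real.sqrt (s i) * (1 + δ i))
    (hδ : ∀ i, |δ i| ≤ εsqrt)
    (U : Matrix (Fin m) (Fin n) ℝ)
    (hU : ∀ i j, |U i j - (A * V * Matrix.diagonal (fun i => (σhat i)⁻¹)) i j|
      ≤ (εV + εU * (1 + εV)) * ((A.map (fun x => |x|) * V.map (fun x => |x|) *
        Matrix.diagonal (fun i => (σhat i)⁻¹)) i j))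
    (hε' : εV + εU * (1 + εV) ≤ 1)
    (hε1 : 2 * εtol + 2 * ((n : ℝ)^2 * εM + εeig) * kappa B ^ 2 +
      4 * (n : ℝ) * Real.sqrt n * (εV + εU * (1 + εV)) * kappa B ≤ 1/2) :
    frob (Uᵀ * U - 1) ≤
      (2 * Real.sqrt n * εsqrt +
        (n : ℝ) * (2 * εtol + 2 * ((n : ℝ)^2 * εM + εeig) * kappa B ^ 2 +
          4 * (n : ℝ) * Real.sqrt n * (εV + εU * (1 + εV)) * kappa B)) /
      (1 - 2 * εsqrt) := by
  rcases Nat.eq_zero_or_pos n with rfl | hn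
  · simp [frob]
  set c := εV + εU * (1 + εV) with hc_def
  have hc : 0 ≤ c := by positivity
  have hn1 : (1 : ℝ) ≤ n := by exact_mod_cast hn
  have hBrank : B.rank = n := by
    refine le_antisymm (by simpa using B.rank_le_width) ?_
    calc n = (B * diagonal d).rank := by rw [← hA, hrank]
      _ ≤ B.rank := Matrix.rank_mul_le_left _ _
  have hspec : 1 ≤ spec B := by
    rw [← hBcols ⟨0, hn⟩]
    exact vnorm_col_le_spec B _
  have hP := spec_nonneg (pinv B)
  have hσ : ∀ i, 0 < Real.sqrt (s i) := fun i => Real.sqrt_pos.mpr (hs i)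
  have hδ0 : ∀ i, 0 < 1 + δ i := fun i => by linarith [(abs_le.mp (hδ i)).1]
  set T : Matrix (Fin n) (Fin n) ℝ := diagonal fun i => (Real.sqrt (s i))⁻¹ with hT
  set Di : Matrix (Fin n) (Fin n) ℝ := diagonal fun i => (d i)⁻¹ with hDi
  set X := diagonal d * V * T with hX
  set W := B * X with hW
  have hDD : diagonal d * Di = 1 := by
    rw [hDi, Matrix.diagonal_mul_diagonal, ← Matrix.diagonal_one]
    exact congrArg _ (funext fun i => mul_inv_cancel₀ (hd i).ne')
  have hDD' : Di * diagonal d = 1 := by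
    rw [hDi, Matrix.diagonal_mul_diagonal, ← Matrix.diagonal_one]
    exact congrArg _ (funext fun i => inv_mul_cancel₀ (hd i).ne')
  have hxw : ∀ j, vnorm (Xᵀ j) ≤ spec (pinv B) * vnorm (Wᵀ j) := by
    intro j
    have h : Xᵀ j = pinv B *ᵥ Wᵀ j := by
      have h1 : X = pinv B * W := by
        rw [hW, ← Matrix.mul_assoc, pinv_mul_self hBrank, Matrix.one_mul]
      exact funext fun k => congrFun (congrFun h1 k) j
    rw [h]
    exact vnorm_mulVec_le _ _
  have hgram : Wᵀ * W - 1 = T * ΔS * T - Xᵀ * (Di * ΔM * Di) * X - Xᵀ * (Di * ΔMh * Di) * X := by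
    have hTST : T * diagonal s * T = 1 := by
      rw [hT, Matrix.diagonal_mul_diagonal, Matrix.diagonal_mul_diagonal, ← Matrix.diagonal_one]
      refine congrArg _ (funext fun i => ?_)
      have h1 := hσ i
      have h2 := Real.mul_self_sqrt (hs i).le
      field_simp
      nlinarith
    have hXt : Xᵀ = T * Vᵀ * diagonal d := by
      simp only [hX, hT, Matrix.transpose_mul, Matrix.diagonal_transpose, Matrix.mul_assoc]
    have hsand : ∀ E : Matrix (Fin n) (Fin n) ℝ,
        Xᵀ * (Di * E * Di) * X = T * (Vᵀ * E * V) * T := by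
      intro E
      calc Xᵀ * (Di * E * Di) * X
          = T * Vᵀ * (diagonal d * Di) * E * (Di * diagonal d) * V * T := by
            rw [hXt, hX]; simp only [Matrix.mul_assoc]
        _ = _ := by rw [hDD, hDD']; simp only [Matrix.mul_assoc, Matrix.mul_one]
    have hWW : Wᵀ * W = T * (Vᵀ * (Aᵀ * A) * V) * T := by
      rw [hW, Matrix.transpose_mul, hXt, hX, hA, Matrix.transpose_mul, Matrix.diagonal_transpose]
      simp only [Matrix.mul_assoc]
    have hT2 : T * (Vᵀ * (Aᵀ * A + ΔM + ΔMh) * V) * T = 1 + T * ΔS * T := by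
      rw [heig, Matrix.mul_add, Matrix.add_mul, hTST]
    simp only [Matrix.mul_add, Matrix.add_mul] at hT2
    rw [hsand, hsand, hWW, eq_sub_of_add_eq (eq_sub_of_add_eq hT2)]
    abel
  set η := ((n : ℝ) ^ 2 * εM + εeig) * kappa B ^ 2 with hη_def
  have hη : 0 ≤ η := by positivity
  set φ := c * Real.sqrt n * kappa B with hφ_def
  have hκ : 0 ≤ kappa B := mul_nonneg (by linarith) hP
  have hφ : 0 ≤ φ := by positivity
  have hφn : φ ≤ n * φ := le_mul_of_one_le_left hφ hn1
  have hε1' : 2 * εtol + 2 * η + 4 * (n * φ) ≤ 1 / 2 := by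
    refine le_trans (le_of_eq ?_) hε1
    rw [hη_def, hφ_def]
    ring
  have hWbound : ∀ i j, |Wᵀ i ⬝ᵥ Wᵀ j - (1 : Matrix (Fin n) (Fin n) ℝ) i j|
      ≤ εtol + η * (vnorm (Wᵀ i) * vnorm (Wᵀ j)) := by
    intro i j
    have h0 : Wᵀ i ⬝ᵥ Wᵀ j - (1 : Matrix (Fin n) (Fin n) ℝ) i j = (Wᵀ * W - (1 : Matrix (Fin n) (Fin n) ℝ)) i j := rfl
    have h1 : |(T * ΔS * T) i j| ≤ εtol := by
      have hi := hσ i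
      have hj := hσ j
      rw [hT, Matrix.mul_diagonal, Matrix.diagonal_mul, abs_mul, abs_mul,
        abs_of_pos (inv_pos.mpr hi), abs_of_pos (inv_pos.mpr hj)]
      calc (√(s i))⁻¹ * |ΔS i j| * (√(s j))⁻¹
          ≤ (√(s i))⁻¹ * (εtol * (√(s i) * √(s j))) * (√(s j))⁻¹ := by
            gcongr
            exact hΔS i j
        _ = εtol := by field_simp
    have h2 : |(Xᵀ * (Di * ΔM * Di) * X) i j| ≤ n * εM * (vnorm (Xᵀ i) * vnorm (Xᵀ j)) := by
      rw [transpose_mul_mul_apply]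
      exact abs_dotProduct_mulVec_le_of_entries hεM
        (abs_scaled_entry_le hd hA hBcols hεM hΔM) _ _
    have h3 : |(Xᵀ * (Di * ΔMh * Di) * X) i j|
        ≤ εeig * spec B ^ 2 * (vnorm (Xᵀ i) * vnorm (Xᵀ j)) := by
      rw [transpose_mul_mul_apply]
      refine (abs_dotProduct_le _ _).trans ?_
      calc _ ≤ vnorm (Xᵀ i) * (εeig * spec B ^ 2 * vnorm (Xᵀ j)) := by
            refine mul_le_mul_of_nonneg_left ((vnorm_mulVec_le _ _).trans ?_) (vnorm_nonneg _)
            exact mul_le_mul_of_nonneg_right hΔMh (vnorm_nonneg _)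
        _ = _ := by ring
    have h4 : (n * εM + εeig * spec B ^ 2) * (vnorm (Xᵀ i) * vnorm (Xᵀ j))
        ≤ η * (vnorm (Wᵀ i) * vnorm (Wᵀ j)) := by
      have hwi := vnorm_nonneg (Wᵀ i)
      have hwj := vnorm_nonneg (Wᵀ j)
      have hsp : 1 ≤ spec B ^ 2 := one_le_pow₀ hspec
      have hnn : (n : ℝ) ≤ n ^ 2 := by nlinarith
      calc (n * εM + εeig * spec B ^ 2) * (vnorm (Xᵀ i) * vnorm (Xᵀ j))
          ≤ ((n ^ 2 * εM + εeig) * spec B ^ 2) *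
            ((spec (pinv B) * vnorm (Wᵀ i)) * (spec (pinv B) * vnorm (Wᵀ j))) := by
            refine mul_le_mul ?_ (mul_le_mul (hxw i) (hxw j) (vnorm_nonneg _) (by positivity))
              (mul_nonneg (vnorm_nonneg _) (vnorm_nonneg _)) (by positivity)
            have h5 : n * εM ≤ n ^ 2 * εM * spec B ^ 2 :=
              (mul_le_mul_of_nonneg_right hnn hεM).trans
                (le_mul_of_one_le_right (by positivity) hsp)
            linarith
        _ = _ := by rw [hη_def, kappa]; ring
    rw [h0, hgram, Matrix.sub_apply, Matrix.sub_apply]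
    have h6 := abs_sub ((T * ΔS * T) i j - (Xᵀ * (Di * ΔM * Di) * X) i j)
      ((Xᵀ * (Di * ΔMh * Di) * X) i j)
    have h7 := abs_sub ((T * ΔS * T) i j) ((Xᵀ * (Di * ΔM * Di) * X) i j)
    linarith
  set F : Matrix (Fin m) (Fin n) ℝ := U * diagonal (fun i => 1 + δ i) - W with hF
  have hAV : ∀ (k : Fin m) (j : Fin n), (A * V) k j * (√(s j))⁻¹ = W k j := by
    intro k j
    rw [hW, hX, hA, hT, ← Matrix.mul_assoc, ← Matrix.mul_assoc, Matrix.mul_diagonal]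
  have hFent : ∀ k j, |F k j| ≤ c * ∑ l, |B k l| * |X l j| := by
    intro k j
    have hj := hσ j
    have hj' := hδ0 j
    have h := hU k j
    rw [Matrix.mul_diagonal, Matrix.mul_diagonal, hσhat, mul_inv, ← mul_assoc, hAV] at h
    have h1 : F k j = (U k j - W k j * (1 + δ j)⁻¹) * (1 + δ j) := by
      rw [hF, Matrix.sub_apply, Matrix.mul_diagonal]
      field_simp
    have h2 : (A.map (fun x => |x|) * V.map (fun x => |x|)) k j * (√(s j))⁻¹
        = ∑ l, |B k l| * |X l j| := by
      rw [Matrix.mul_apply, Finset.sum_mul]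
      refine Finset.sum_congr rfl fun l _ => ?_
      simp only [hA, hX, hT, Matrix.map_apply, Matrix.mul_diagonal, Matrix.diagonal_mul, abs_mul,
        abs_of_pos (hd l), abs_of_pos (inv_pos.mpr hj)]
      ring
    rw [h1, abs_mul, abs_of_pos hj']
    refine (mul_le_mul_of_nonneg_right h hj'.le).trans_eq ?_
    rw [← mul_assoc ((A.map (fun x => |x|) * V.map (fun x => |x|)) k j), h2]
    field_simp
  have hFcol : ∀ j, vnorm (Fᵀ j) ≤ φ * vnorm (Wᵀ j) := by
    intro j
    have hwj := vnorm_nonneg (Wᵀ j)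
    refine (vnorm_col_le_of_abs_le hc hBcols hFent j).trans ?_
    calc c * √n * vnorm (Xᵀ j) ≤ c * √n * (spec (pinv B) * vnorm (Wᵀ j)) :=
          mul_le_mul_of_nonneg_left (hxw j) (by positivity)
      _ ≤ c * √n * (spec B * spec (pinv B) * vnorm (Wᵀ j)) := by
          refine mul_le_mul_of_nonneg_left (mul_le_mul_of_nonneg_right ?_ hwj) (by positivity)
          exact le_mul_of_one_le_left hP hspec
      _ = φ * vnorm (Wᵀ j) := by rw [hφ_def, kappa]; ring
  have hG : ∀ i j, |((W + F)ᵀ * (W + F) - (1 : Matrix (Fin n) (Fin n) ℝ)) i j| ≤ 2 * εtol + 2 * η + 4 * (n * φ) := fun i j =>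
    (abs_gram_add_sub_one_le hεtol hη (by linarith) hφ (by linarith) hWbound hFcol i j).trans
      (by linarith)
  have hUeq : U = (W + F) * diagonal fun i => (1 + δ i)⁻¹ := by
    rw [hF, add_sub_cancel, Matrix.mul_assoc, Matrix.diagonal_mul_diagonal]
    ext k j
    rw [Matrix.mul_diagonal, mul_inv_cancel₀ (hδ0 j).ne', mul_one]
  have hfin := frob_gram_scaled_sub_one_le hδ hεsqrt hεsqrt' (by positivity) hG
  rw [← hUeq] at hfin
  refine hfin.trans_eq ?_
  rw [hη_def, hφ_def]
  ring
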